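/- arXiv:1909.01294 — 2 statements merged into one kernel-verified Lean document; each statement's English description precedes it below -/
import Mathlib

section
/- For every feasible point z̄ ∈ 𝒰 of the generalized Ramsey model with default, the section S_{ȳ} := φ(𝒰) ∩ ({ȳ} − ℝ^H_{≥0}) with ȳ := φ(z̄), i.e. the set {φ(z) : z ∈ 𝒰, φ_h(z) ≤ φ_h(z̄) for all h = 1,…,H}, is a nonempty compact subset of ℝ^H. -/
/-- Feasibility for the generalized Ramsey model with default. -/
def Feasible (H T : ℕ) (r ω : ℕ → ℝ) (l : Fin H → ℝ) (τ δ : ℝ)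
    (a0 : Fin H → ℝ) (c a : Fin H → ℕ → ℝ) : Prop :=
  (∀ h, a h 0 = a0 h) ∧
  (∀ h : Fin H, ∀ t ≤ T, 0 < c h t) ∧
  (∀ h : Fin H, ∀ t ≤ T,
    a h (t + 1) = τ * ω t * l h + (τ * (1 + r t) - δ) * a h t - τ * c h t) ∧
  (∀ t ≤ T, 0 ≤ ∑ h, a h (t + 1))

/-- The vector-valued objective `φ_h(z) = −Σ_{t=0}^T (β^h)^t u^h(c_t^h)`. -/
def Phi {H : ℕ} (T : ℕ) (β : Fin H → ℝ) (u : Fin H → ℝ → ℝ)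
    (c : Fin H → ℕ → ℝ) (h : Fin H) : ℝ :=
  -∑ t ∈ Finset.range (T + 1), β h ^ t * u h (c h t)

open Filter Topology Set

def Slope (f : ℝ → ℝ) (x d k : ℝ) : Prop :=
  ∀ᶠ ε in 𝓝[>] (0:ℝ), k * ε ≤ f (x + ε * d) - f x

lemma slope_pos {f : ℝ → ℝ} {x d k f' : ℝ} (hf : HasDerivAt f f' x) (hk : k < f' * d) :
    Slope f x d k := by
  have h1 : HasDerivAt (fun ε : ℝ => f (x + ε * d)) (f' * d) 0 := by
    have h2 : HasDerivAt (fun ε : ℝ => x + ε * d) d 0 := by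
      simpa using ((hasDerivAt_id (0:ℝ)).mul_const d).const_add x
    have h3 : HasDerivAt f f' (x + 0 * d) := by simpa using hf
    exact h3.comp (0:ℝ) h2
  have h4 := h1.tendsto_slope_zero_right
  have h5 := h4.eventually (lt_mem_nhds hk)
  unfold Slope
  filter_upwards [h5, self_mem_nhdsWithin] with ε h6 h7
  have h7 : 0 < ε := h7
  simp only [zero_add, zero_mul, add_zero, smul_eq_mul] at h6
  rw [inv_mul_eq_div, lt_div_iff₀ h7] at h6
  exact h6.le

lemma slope_sum (T : ℕ) (β : ℝ) (hβ : 0 < β) (f : ℝ → ℝ) (c d k : ℕ → ℝ)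
    (hs : ∀ t ≤ T, Slope f (c t) (d t) (k t))
    (hk : 0 ≤ ∑ t ∈ Finset.range (T+1), β ^ t * k t) :
    ∀ᶠ ε in 𝓝[>] (0:ℝ), ∑ t ∈ Finset.range (T+1), β ^ t * f (c t) ≤
      ∑ t ∈ Finset.range (T+1), β ^ t * f (c t + ε * d t) := by
  have h1 : ∀ᶠ ε in 𝓝[>] (0:ℝ), ∀ t ∈ Finset.range (T+1),
      k t * ε ≤ f (c t + ε * d t) - f (c t) := by
    rw [Filter.eventually_all_finset]
    intro t ht
    exact hs t (by simp at ht; omega)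
  filter_upwards [h1, self_mem_nhdsWithin] with ε h2 h3
  have h3 : 0 < ε := h3
  have h4 : ∑ t ∈ Finset.range (T+1), β ^ t * (k t * ε) ≤
      ∑ t ∈ Finset.range (T+1), β ^ t * (f (c t + ε * d t) - f (c t)) :=
    Finset.sum_le_sum fun t ht => mul_le_mul_of_nonneg_left (h2 t ht) (by positivity)
  have h5 : ∑ t ∈ Finset.range (T+1), β ^ t * (k t * ε) =
      (∑ t ∈ Finset.range (T+1), β ^ t * k t) * ε := by
    rw [Finset.sum_mul]; exact Finset.sum_congr rfl fun t _ => by ring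
  simp only [mul_sub, Finset.sum_sub_distrib] at h4
  have := mul_nonneg hk h3.le
  simp only [h5] at h4
  linarith

/-- choose the slope at one date large enough -/
lemma exists_big (T s : ℕ) (hs : s ≤ T) (β : ℝ) (hβ : 0 < β) (k : ℕ → ℝ) :
    ∃ K : ℝ, 0 ≤ ∑ t ∈ Finset.range (T+1), β ^ t * (if t = s then K else k t) := by
  have hm : s ∈ Finset.range (T+1) := by simp; omega
  refine ⟨-(∑ t ∈ (Finset.range (T+1)).erase s, β ^ t * k t) / β ^ s, ?_⟩
  rw [← Finset.add_sum_erase _ _ hm]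
  have : ∑ t ∈ (Finset.range (T+1)).erase s, β ^ t *
      (if t = s then -(∑ t ∈ (Finset.range (T+1)).erase s, β ^ t * k t) / β ^ s else k t) =
      ∑ t ∈ (Finset.range (T+1)).erase s, β ^ t * k t := by
    apply Finset.sum_congr rfl
    intro t ht
    rw [if_neg (Finset.ne_of_mem_erase ht)]
  rw [this, if_pos rfl, mul_div_cancel₀ _ (by positivity)]
  simp

lemma util_mono (u u' : ℝ → ℝ) (hu1 : ∀ x > (0:ℝ), HasDerivAt u (u' x) x)
    (hp : ∀ x > (0:ℝ), 0 < u' x) : StrictMonoOn u (Ioi 0) := by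
  apply strictMonoOn_of_deriv_pos (convex_Ioi 0)
  · intro x hx
    exact (hu1 x hx).continuousAt.continuousWithinAt
  · intro x hx
    rw [interior_Ioi] at hx
    rw [(hu1 x hx).deriv]
    exact hp x hx

lemma util_ext (T : ℕ) (β : ℝ) (hβ0 : 0 < β) (hβ1 : β < 1) (u u' : ℝ → ℝ)
    (hu1 : ∀ x > (0:ℝ), HasDerivAt u (u' x) x)
    (hp : ∀ x > (0:ℝ), 0 < u' x)
    (hz : Tendsto u' (𝓝[>] 0) atTop) (C y : ℝ) :
    ∃ (m : ℝ) (f : ℝ → ℝ), 0 ≤ m ∧ (∀ x > 0, f x = u x) ∧ ContinuousOn f (Ici m) ∧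
      (m = 0 → (∀ k d, 0 < d → Slope f 0 d k) ∧ ∀ x > 0, f 0 < f x) ∧
      (∀ c : ℕ → ℝ, (∀ t ≤ T, 0 < c t ∧ c t ≤ C) →
        y ≤ ∑ t ∈ Finset.range (T+1), β ^ t * u (c t) → ∀ t ≤ T, m ≤ c t) := by
  have hmono := util_mono u u' hu1 hp
  have hcont : ContinuousOn u (Ioi 0) := fun x hx => (hu1 x hx).continuousAt.continuousWithinAt
  by_cases hb : BddBelow (u '' Ioi 0)
  · set L := sInf (u '' Ioi 0) with hL
    have hlim : Tendsto u (𝓝[>] 0) (𝓝 L) := hmono.monotoneOn.tendsto_nhdsGT hb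
    have hle : ∀ x > 0, L < u x := by
      intro x hx
      have h1 : L ≤ u (x/2) := csInf_le hb ⟨x/2, by simp; linarith, rfl⟩
      have h2 : u (x/2) < u x := hmono (by simp; linarith) hx (by linarith)
      linarith
    have hfx : ∀ x > 0, Function.update u 0 L x = u x := fun x hx =>
      Function.update_of_ne hx.ne' _ _
    have hfc : ContinuousOn (Function.update u 0 L) (Ici 0) := by
      rw [continuousOn_update_iff]
      constructor
      · simpa using hcont
      · intro _
        simpa using hlim
    refine ⟨0, Function.update u 0 L, le_refl _, hfx, hfc, ?_, ?_⟩
    · intro _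
      refine ⟨?_, ?_⟩
      · intro k d hd
        have h1 := hz.eventually (eventually_ge_atTop (k/d))
        obtain ⟨e, he, h2⟩ := mem_nhdsGT_iff_exists_Ioo_subset.1 h1
        have he : 0 < e := he
        have h3 : ∀ᶠ ε in 𝓝[>] (0:ℝ), ε ∈ Ioo 0 (e/d) := Ioo_mem_nhdsGT (by positivity)
        unfold Slope
        filter_upwards [h3] with ε hε
        have hpos : 0 < ε * d := mul_pos hε.1 hd
        have hlt : ε * d < e := (lt_div_iff₀ hd).1 hε.2
        obtain ⟨ξ, hξ, h4⟩ := exists_hasDerivAt_eq_slope (Function.update u 0 L) u' hpos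
          (hfc.mono Icc_subset_Ici_self) (by
            intro x hx
            apply (hu1 x hx.1).congr_of_eventuallyEq
            filter_upwards [lt_mem_nhds hx.1] with z hz
            exact hfx z hz)
        have h5 : k / d ≤ u' ξ := h2 ⟨hξ.1, hξ.2.trans hlt⟩
        rw [h4, div_le_div_iff₀ hd (by linarith)] at h5
        rw [zero_add]
        have h6 : (k * ε) * d ≤ (Function.update u 0 L (ε * d) - Function.update u 0 L 0) * d := by
          linarith
        exact le_of_mul_le_mul_right h6 hd
      · intro x hx
        rw [hfx x hx]; simpa using hle x hx
    · intro c hc _ t ht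
      exact (hc t ht).1.le
  · rw [not_bddBelow_iff] at hb
    set D := ∑ t ∈ Finset.range (T+1), β ^ t * |u C| with hD
    have hDn : 0 ≤ D := Finset.sum_nonneg fun t _ => by positivity
    obtain ⟨_, ⟨m, hm, rfl⟩, h1⟩ := hb (-(|y| + D) / β ^ T)
    have hm : 0 < m := hm
    refine ⟨m, u, hm.le, fun _ _ => rfl, hcont.mono (fun x hx => lt_of_lt_of_le hm hx),
      fun h => absurd h hm.ne', ?_⟩
    intro c hc hy t ht
    by_contra hlt
    push Not at hlt
    have h2 : u (c t) < u m := hmono (hc t ht).1 hm hlt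
    have hmem : t ∈ Finset.range (T+1) := by simp; omega
    rw [← Finset.add_sum_erase _ _ hmem] at hy
    have h3 : ∑ s ∈ (Finset.range (T+1)).erase t, β ^ s * u (c s) ≤
        ∑ s ∈ (Finset.range (T+1)).erase t, β ^ s * |u C| := by
      apply Finset.sum_le_sum
      intro s hs
      have hs' : s ≤ T := by simp at hs; omega
      apply mul_le_mul_of_nonneg_left _ (by positivity)
      have := hmono.monotoneOn (hc s hs').1 ((hc s hs').1.trans_le (hc s hs').2 : (0:ℝ) < C) (hc s hs').2
      exact this.trans (le_abs_self _)
    have h4 : ∑ s ∈ (Finset.range (T+1)).erase t, β ^ s * |u C| ≤ D :=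
      Finset.sum_le_sum_of_subset_of_nonneg (Finset.erase_subset _ _) fun s _ _ => by positivity
    have h5 : u (c t) < -(|y| + D) / β ^ T := h2.trans h1
    have hT : 0 < β ^ T := by positivity
    rw [lt_div_iff₀ hT] at h5
    have h6 : β ^ T ≤ β ^ t := pow_le_pow_of_le_one hβ0.le hβ1.le ht
    have h7 : u (c t) ≤ 0 := by
      by_contra h
      push Not at h
      have := mul_pos h hT
      have := abs_nonneg y
      linarith
    have h8 : β ^ t * u (c t) ≤ u (c t) * β ^ T := by nlinarith
    have := neg_abs_le y
    linarith

/-- aggregate assets -/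
noncomputable def Ag (τ δ A0 L : ℝ) (r ω : ℕ → ℝ) (x : ℕ → ℝ) : ℕ → ℝ
  | 0 => A0
  | t+1 => τ * ω t * L + (τ * (1 + r t) - δ) * Ag τ δ A0 L r ω x t - τ * x t

noncomputable def Ast (τ δ : ℝ) (r ω : ℕ → ℝ) (l a0 : ℝ) (c : ℕ → ℝ) : ℕ → ℝ
  | 0 => a0
  | t+1 => τ * ω t * l + (τ * (1 + r t) - δ) * Ast τ δ r ω l a0 c t - τ * c t

lemma Ag_anti (τ δ A0 L : ℝ) (r ω x y : ℕ → ℝ) (T : ℕ) (hτ : 0 ≤ τ)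
    (hR : ∀ t ≤ T, 0 ≤ τ * (1 + r t) - δ) (hxy : ∀ t ≤ T, x t ≤ y t) :
    ∀ t ≤ T + 1, Ag τ δ A0 L r ω y t ≤ Ag τ δ A0 L r ω x t := by
  intro t
  induction t with
  | zero => intro _; exact le_refl _
  | succ t ih =>
    intro ht
    have h1 := mul_le_mul_of_nonneg_left (ih (by omega)) (hR t (by omega))
    have h2 := mul_le_mul_of_nonneg_left (hxy t (by omega)) hτ
    simp only [Ag]
    linarith

lemma Ag_affine (τ δ A0 L : ℝ) (r ω x y z : ℕ → ℝ) (T : ℕ) (e : ℝ)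
    (hz : ∀ t ≤ T, z t = x t + e * (y t - x t)) :
    ∀ t ≤ T + 1, Ag τ δ A0 L r ω z t =
      (1 - e) * Ag τ δ A0 L r ω x t + e * Ag τ δ A0 L r ω y t := by
  intro t
  induction t with
  | zero => intro _; simp only [Ag]; ring
  | succ t ih =>
    intro ht
    simp only [Ag]
    rw [ih (by omega), hz t (by omega)]
    ring

lemma Ag_congr (τ δ A0 L : ℝ) (r ω x y : ℕ → ℝ) (T : ℕ)
    (hxy : ∀ t ≤ T, x t = y t) :
    ∀ t ≤ T + 1, Ag τ δ A0 L r ω y t = Ag τ δ A0 L r ω x t := by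
  intro t
  induction t with
  | zero => intro _; rfl
  | succ t ih =>
    intro ht
    simp only [Ag]
    rw [ih (by omega), hxy t (by omega)]

lemma feas_agg {H T : ℕ} {r ω : ℕ → ℝ} {l a0 : Fin H → ℝ} {τ δ : ℝ} {c a : Fin H → ℕ → ℝ}
    (h0 : ∀ h, a h 0 = a0 h)
    (h1 : ∀ h : Fin H, ∀ t ≤ T,
      a h (t + 1) = τ * ω t * l h + (τ * (1 + r t) - δ) * a h t - τ * c h t) :
    ∀ t ≤ T + 1, ∑ h, a h t = Ag τ δ (∑ h, a0 h) (∑ h, l h) r ω (fun t => ∑ h, c h t) t := by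
  intro t
  induction t with
  | zero => intro _; simp only [Ag, h0]
  | succ t ih =>
    intro ht
    simp only [Ag]
    rw [← ih (by omega), Finset.sum_congr rfl fun h _ => h1 h t (by omega)]
    rw [Finset.sum_sub_distrib, Finset.sum_add_distrib, Finset.mul_sum, Finset.mul_sum,
      Finset.mul_sum]

lemma feas_iff {H T : ℕ} {r ω : ℕ → ℝ} {l a0 : Fin H → ℝ} {τ δ : ℝ} {c : Fin H → ℕ → ℝ} :
    (∃ a, Feasible H T r ω l τ δ a0 c a) ↔ (∀ h : Fin H, ∀ t ≤ T, 0 < c h t) ∧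
      ∀ t ≤ T, 0 ≤ Ag τ δ (∑ h, a0 h) (∑ h, l h) r ω (fun t => ∑ h, c h t) (t+1) := by
  constructor
  · rintro ⟨a, h0, h1, h2, h3⟩
    refine ⟨h1, fun t ht => ?_⟩
    rw [← feas_agg h0 h2 (t+1) (by omega)]
    exact h3 t ht
  · rintro ⟨h1, h2⟩
    have h3 : ∀ h : Fin H, ∀ t ≤ T,
      (fun h => Ast τ δ r ω (l h) (a0 h) (c h)) h (t + 1) = τ * ω t * l h + (τ * (1 + r t) - δ) *
      (fun h => Ast τ δ r ω (l h) (a0 h) (c h)) h t - τ * c h t := fun h t _ => rfl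
    refine ⟨fun h => Ast τ δ r ω (l h) (a0 h) (c h), fun h => rfl, h1, h3, ?_⟩
    intro t ht
    have := feas_agg (fun h => rfl) h3 (t+1) (by omega)
    rw [this]
    exact h2 t ht

/-- Free disposal: hit a prescribed utility level exactly. -/
lemma disposal (T : ℕ) (β : ℝ) (hβ0 : 0 < β) (u : ℝ → ℝ)
    (hc : ContinuousOn u (Ioi 0)) (hm : MonotoneOn u (Ioi 0)) (c b : ℕ → ℝ) (y : ℝ)
    (hcp : ∀ t ≤ T, 0 < c t) (hbp : ∀ t ≤ T, 0 < b t)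
    (h1 : y ≤ ∑ t ∈ Finset.range (T+1), β ^ t * u (c t))
    (h2 : ∑ t ∈ Finset.range (T+1), β ^ t * u (b t) ≤ y) :
    ∃ e : ℕ → ℝ, (∀ t ≤ T, 0 < e t ∧ e t ≤ c t) ∧
      ∑ t ∈ Finset.range (T+1), β ^ t * u (e t) = y := by
  have hpos : ∀ s ∈ Icc (0:ℝ) 1, ∀ t ≤ T, 0 < c t - s * (c t - min (c t) (b t)) := by
    intro s hs t ht
    have h3 : 0 < min (c t) (b t) := lt_min (hcp t ht) (hbp t ht)
    have h4 : min (c t) (b t) ≤ c t := min_le_left _ _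
    nlinarith [hs.1, hs.2]
  have hg : ContinuousOn (fun s : ℝ => ∑ t ∈ Finset.range (T+1),
      β ^ t * u (c t - s * (c t - min (c t) (b t)))) (Icc 0 1) := by
    apply continuousOn_finsetSum
    intro t ht
    apply ContinuousOn.mul continuousOn_const
    apply hc.comp (by fun_prop)
    intro s hs
    exact hpos s hs t (by simp at ht; omega)
  obtain ⟨s, hs, h3⟩ := intermediate_value_Icc' (zero_le_one) hg (show y ∈ _ by
    constructor
    · refine le_trans (Finset.sum_le_sum fun t ht => ?_) h2
      have ht : t ≤ T := by simp at ht; omega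
      apply mul_le_mul_of_nonneg_left _ (by positivity)
      apply hm (hpos 1 (by simp) t ht) (hbp t ht)
      have := min_le_right (c t) (b t)
      linarith
    · simpa using h1)
  refine ⟨fun t => c t - s * (c t - min (c t) (b t)), fun t ht => ⟨hpos s hs t ht, ?_⟩, h3⟩
  have h4 : min (c t) (b t) ≤ c t := min_le_left _ _
  have := mul_nonneg hs.1 (sub_nonneg.2 h4)
  simp only
  linarith

lemma perturb (H T : ℕ) (r ω : ℕ → ℝ) (β : Fin H → ℝ) (τ δ A0 L : ℝ)
    (hβ : ∀ h, 0 < β h) (f u' : Fin H → ℝ → ℝ)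
    (hu1 : ∀ h : Fin H, ∀ x > (0:ℝ), HasDerivAt (f h) (u' h x) x)
    (hu'pos : ∀ h : Fin H, ∀ x > (0:ℝ), 0 < u' h x)
    (c b : Fin H → ℕ → ℝ) (hc : ∀ h, ∀ t ≤ T, 0 ≤ c h t) (hb : ∀ h, ∀ t ≤ T, 0 < b h t)
    (hz : ∀ h, ∀ t ≤ T, c h t = 0 → ∀ k d, 0 < d → Slope (f h) 0 d k)
    (hs : ∀ h, ∃ s ≤ T, 0 < c h s)
    (hAc : ∀ t ≤ T, 0 ≤ Ag τ δ A0 L r ω (fun t => ∑ h, c h t) (t+1))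
    (hAb : ∀ t ≤ T, 0 ≤ Ag τ δ A0 L r ω (fun t => ∑ h, b h t) (t+1)) :
    ∃ e : Fin H → ℕ → ℝ, (∀ h, ∀ t ≤ T, 0 < e h t) ∧
      (∀ t ≤ T, 0 ≤ Ag τ δ A0 L r ω (fun t => ∑ h, e h t) (t+1)) ∧
      ∀ h, ∑ t ∈ Finset.range (T+1), β h ^ t * f h (c h t) ≤
        ∑ t ∈ Finset.range (T+1), β h ^ t * f h (e h t) := by
  by_cases hzero : ∃ h, ∃ t ≤ T, c h t = 0
  swap
  · push Not at hzero
    exact ⟨c, fun h t ht => lt_of_le_of_ne (hc h t ht) (hzero h t ht).symm, hAc, fun h => le_refl _⟩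
  obtain ⟨h0, t0, ht0, hct0⟩ := hzero
  obtain ⟨s0, hs0, hcs0⟩ := hs h0
  have hne : t0 ≠ s0 := by rintro rfl; linarith
  -- a crude slope at any coordinate
  have hcrude : ∀ h, ∀ t ≤ T, ∀ d, (c h t = 0 → 0 < d) →
      Slope (f h) (c h t) d (u' h (c h t) * d - 1) := by
    intro h t ht d hd
    rcases (hc h t ht).eq_or_lt with h1 | h1
    · have := hz h t ht h1.symm (u' h (c h t) * d - 1) d (hd h1.symm)
      rw [← h1] at this ⊢
      exact this
    · exact slope_pos (hu1 h _ h1) (by linarith)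
  -- the size of the transfer
  have hM : ∀ h, ∃ M0 : ℝ, ∀ M ≥ M0, 0 ≤ M → h ≠ h0 → ∀ᶠ ε in 𝓝[>] (0:ℝ),
      ∑ t ∈ Finset.range (T+1), β h ^ t * f h (c h t) ≤
      ∑ t ∈ Finset.range (T+1), β h ^ t *
        f h (c h t + ε * (b h t - c h t + if t = s0 then M else 0)) := by
    intro h
    obtain ⟨K, hK⟩ := exists_big T s0 hs0 (β h) (hβ h)
      (fun t => u' h (c h t) * (b h t - c h t) - 1)
    rcases (hc h s0 hs0).eq_or_lt with h1 | h1
    · refine ⟨0, fun M _ hM0 _ => slope_sum T (β h) (hβ h) (f h) (c h) _ _ ?_ hK⟩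
      intro t ht
      by_cases hts : t = s0
      · subst hts
        rw [if_pos rfl, if_pos rfl, ← h1]
        exact hz h t ht h1.symm _ _ (by have := hb h t ht; linarith)
      · rw [if_neg hts, if_neg hts, add_zero]
        exact hcrude h t ht _ (fun h2 => by have := hb h t ht; linarith)
    · refine ⟨(K + 1) / u' h (c h s0) - (b h s0 - c h s0), fun M hM hM0 _ =>
        slope_sum T (β h) (hβ h) (f h) (c h) _ _ ?_ hK⟩
      intro t ht
      by_cases hts : t = s0
      · subst hts
        rw [if_pos rfl, if_pos rfl]
        apply slope_pos (hu1 h _ h1)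
        have h2 : (K + 1) / u' h (c h t) ≤ b h t - c h t + M := by linarith
        rw [div_le_iff₀ (hu'pos h _ h1)] at h2
        linarith
      · rw [if_neg hts, if_neg hts, add_zero]
        exact hcrude h t ht _ (fun h2 => by have := hb h t ht; linarith)
  choose M0 hM0 using hM
  set M := ∑ h, |M0 h| with hMdef
  have hMn : 0 ≤ M := Finset.sum_nonneg fun h _ => abs_nonneg _
  have hMge : ∀ h, M ≥ M0 h := fun h => (le_abs_self _).trans
    (Finset.single_le_sum (f := fun h => |M0 h|) (fun i _ => abs_nonneg _) (Finset.mem_univ h))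
  set d : Fin H → ℕ → ℝ := fun h t => b h t - c h t +
    if t = s0 then (M - if h = h0 then (H:ℝ) * M else 0) else 0 with hd
  have hdz : ∀ h, ∀ t ≤ T, c h t = 0 → 0 < d h t := by
    intro h t ht h1
    have h2 := hb h t ht
    simp only [hd]
    by_cases hts : t = s0
    · by_cases hh : h = h0
      · subst hh hts; linarith
      · rw [if_pos hts, if_neg hh]; linarith
    · rw [if_neg hts]; linarith
  have hU : ∀ h, ∀ᶠ ε in 𝓝[>] (0:ℝ),
      ∑ t ∈ Finset.range (T+1), β h ^ t * f h (c h t) ≤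
      ∑ t ∈ Finset.range (T+1), β h ^ t * f h (c h t + ε * d h t) := by
    intro h
    by_cases hh : h = h0
    · subst hh
      obtain ⟨K, hK⟩ := exists_big T t0 ht0 (β h) (hβ h)
        (fun t => u' h (c h t) * d h t - 1)
      refine slope_sum T (β h) (hβ h) (f h) (c h) _ _ ?_ hK
      intro t ht
      by_cases hts : t = t0
      · subst hts
        rw [if_pos rfl, hct0]
        exact hz h t ht hct0 _ _ (hdz h t ht hct0)
      · rw [if_neg hts]
        exact hcrude h t ht _ (hdz h t ht)
    · have := hM0 h M (hMge h) hMn hh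
      simpa only [hd, if_neg hh, sub_zero] using this
  have hP : ∀ h, ∀ t ∈ Finset.range (T+1), ∀ᶠ ε in 𝓝[>] (0:ℝ), 0 < c h t + ε * d h t := by
    intro h t ht
    have ht : t ≤ T := by simp at ht; omega
    rcases (hc h t ht).eq_or_lt with h1 | h1
    · filter_upwards [self_mem_nhdsWithin] with ε hε
      rw [← h1, zero_add]
      exact mul_pos hε (hdz h t ht h1.symm)
    · have : Tendsto (fun ε : ℝ => c h t + ε * d h t) (𝓝[>] 0) (𝓝 (c h t + 0 * d h t)) :=
        (Continuous.tendsto (by fun_prop) 0).mono_left nhdsWithin_le_nhds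
      rw [zero_mul, add_zero] at this
      exact this.eventually (lt_mem_nhds h1)
  have h1 : ∀ᶠ ε in 𝓝[>] (0:ℝ), ε ∈ Ioo (0:ℝ) 1 := Ioo_mem_nhdsGT one_pos
  have hP' : ∀ᶠ ε in 𝓝[>] (0:ℝ), ∀ h, ∀ t ∈ Finset.range (T+1), 0 < c h t + ε * d h t := by
    rw [Filter.eventually_all]
    intro h
    rw [Filter.eventually_all_finset]
    exact hP h
  obtain ⟨ε, hε, hpos, hup⟩ := (h1.and (hP'.and (Filter.eventually_all.2 hU))).exists
  refine ⟨fun h t => c h t + ε * d h t, fun h t ht => hpos h t (by simp; omega), ?_, hup⟩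
  intro t ht
  rw [Ag_affine τ δ A0 L r ω (fun t => ∑ h, c h t) (fun t => ∑ h, b h t) _ T ε ?_ (t+1) (by omega)]
  · have := mul_nonneg (sub_nonneg.2 hε.2.le) (hAc t ht)
    have := mul_nonneg hε.1.le (hAb t ht)
    linarith
  · intro t ht
    have hdsum : ∑ h, d h t = ∑ h, b h t - ∑ h, c h t := by
      simp only [hd]
      rw [Finset.sum_add_distrib, Finset.sum_sub_distrib]
      by_cases hts : t = s0
      · simp [hts, Finset.sum_sub_distrib]
      · simp [hts]
    rw [Finset.sum_add_distrib, ← Finset.mul_sum, hdsum]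

lemma Ag_cont {X : Type*} [TopologicalSpace X] (τ δ A0 L : ℝ) (r ω : ℕ → ℝ) (x : X → ℕ → ℝ)
    (hx : ∀ t, Continuous fun p => x p t) (t : ℕ) :
    Continuous fun p => Ag τ δ A0 L r ω (x p) t := by
  induction t with
  | zero => exact continuous_const
  | succ t ih =>
    simp only [Ag]
    have := hx t
    fun_prop

/-- for every feasible point `z̄`, the section
`S_{ȳ} = {φ(z) : z ∈ 𝒰, φ_h(z) ≤ φ_h(z̄) ∀h}` is a nonempty compact subset of `ℝ^H`. -/
theorem section_nonempty_compact (H T : ℕ) (hH : 1 ≤ H)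
    (r ω : ℕ → ℝ) (l β : Fin H → ℝ) (τ δ : ℝ) (a0 : Fin H → ℝ)
    (hr : ∀ t ≤ T, 0 < r t) (hω : ∀ t ≤ T, 1 ≤ ω t)
    (hl : ∀ h, 0 < l h) (hβ : ∀ h, 0 < β h ∧ β h < 1)
    (hτ : 1 ≤ τ) (hδ0 : 0 < δ) (hδ1 : δ < 1)
    (ha0 : 0 < ∑ h, a0 h)
    (u u' u'' : Fin H → ℝ → ℝ)
    (hu1 : ∀ h : Fin H, ∀ x > (0:ℝ), HasDerivAt (u h) (u' h x) x)
    (hu2 : ∀ h : Fin H, ∀ x > (0:ℝ), HasDerivAt (u' h) (u'' h x) x)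
    (hu2c : ∀ h : Fin H, ContinuousOn (u'' h) (Set.Ioi 0))
    (hu'pos : ∀ h : Fin H, ∀ x > (0:ℝ), 0 < u' h x)
    (hu''neg : ∀ h : Fin H, ∀ x > (0:ℝ), u'' h x < 0)
    (hu'top : ∀ h : Fin H, Filter.Tendsto (u' h) Filter.atTop (nhds 0))
    (hu'zero : ∀ h : Fin H,
      Filter.Tendsto (u' h) (nhdsWithin 0 (Set.Ioi 0)) Filter.atTop)
    (cbar abar : Fin H → ℕ → ℝ) (hfeas : Feasible H T r ω l τ δ a0 cbar abar) :
    ({y : Fin H → ℝ | ∃ c a : Fin H → ℕ → ℝ, Feasible H T r ω l τ δ a0 c a ∧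
        y = Phi T β u c ∧
        ∀ h : Fin H, Phi T β u c h ≤ Phi T β u cbar h}).Nonempty ∧
    IsCompact {y : Fin H → ℝ | ∃ c a : Fin H → ℕ → ℝ,
        Feasible H T r ω l τ δ a0 c a ∧ y = Phi T β u c ∧
        ∀ h : Fin H, Phi T β u c h ≤ Phi T β u cbar h} := by
  have hR : ∀ t ≤ T, 0 ≤ τ * (1 + r t) - δ := by
    intro t ht
    have := hr t ht
    nlinarith
  have hτ0 : 0 < τ := by linarith
  refine ⟨⟨_, cbar, abar, hfeas, rfl, fun h => le_refl _⟩, ?_⟩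
  obtain ⟨hbpos, hAb⟩ := feas_iff.1 ⟨abar, hfeas⟩
  set A0 := ∑ h, a0 h with hA0
  set L := ∑ h, l h with hL
  -- uniform bound on consumption
  set B := Ag τ δ A0 L r ω (fun _ => 0) with hB
  set C := ∑ t ∈ Finset.range (T+1), |B (t+1)| / τ with hC
  have hbound : ∀ c : Fin H → ℕ → ℝ, (∀ h : Fin H, ∀ t ≤ T, 0 < c h t) →
      (∀ t ≤ T, 0 ≤ Ag τ δ A0 L r ω (fun t => ∑ h, c h t) (t+1)) →
      ∀ h, ∀ t ≤ T, c h t ≤ C := by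
    intro c hc hA h t ht
    have hsn : ∀ t ≤ T, 0 ≤ ∑ h, c h t := fun t ht => Finset.sum_nonneg fun h _ => (hc h t ht).le
    have h1 := Ag_anti τ δ A0 L r ω (fun _ => 0) (fun t => ∑ h, c h t) T hτ0.le hR hsn t (by omega)
    have h2 := hA t ht
    have h3 : B (t+1) = τ * ω t * L + (τ * (1 + r t) - δ) * B t - τ * 0 := rfl
    have h4 := mul_le_mul_of_nonneg_left h1 (hR t ht)
    simp only [Ag] at h2
    have h5 : c h t ≤ ∑ h, c h t :=
      Finset.single_le_sum (f := fun h => c h t) (fun i _ => (hc i t ht).le) (Finset.mem_univ h)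
    have h6 : τ * (∑ h, c h t) ≤ B (t+1) := by rw [h3]; linarith
    have h7 : ∑ h, c h t ≤ |B (t+1)| / τ := by
      rw [le_div_iff₀ hτ0]
      have := le_abs_self (B (t+1))
      linarith
    have h8 : |B (t+1)| / τ ≤ C :=
      Finset.single_le_sum (f := fun t => |B (t+1)| / τ) (fun i _ => by positivity)
        (by simp; omega : t ∈ Finset.range (T+1))
    linarith
  choose m f hm0 hfu hfc hfz hfm using fun h => util_ext T (β h) (hβ h).1 (hβ h).2 (u h) (u' h)
    (hu1 h) (hu'pos h) (hu'zero h) C (-Phi T β u cbar h)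
  have hfderiv : ∀ h : Fin H, ∀ x > (0:ℝ), HasDerivAt (f h) (u' h x) x := by
    intro h x hx
    apply (hu1 h x hx).congr_of_eventuallyEq
    filter_upwards [lt_mem_nhds hx] with z hz
    exact hfu h z hz
  have hPf : ∀ c : Fin H → ℕ → ℝ, (∀ h : Fin H, ∀ t ≤ T, 0 < c h t) →
      Phi T β f c = Phi T β u c := by
    intro c hc
    funext h
    simp only [Phi]
    congr 1
    apply Finset.sum_congr rfl
    intro t ht
    rw [hfu h _ (hc h t (by simp at ht; omega))]
  -- the compact parameter set
  set Box : Set (Fin H → ℕ → ℝ) := Set.pi univ fun h => Set.pi univ fun _ => Icc (m h) C with hBox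
  have hBoxc : IsCompact Box := isCompact_univ_pi fun h => isCompact_univ_pi fun _ => isCompact_Icc
  have hPc : ContinuousOn (fun c => Phi T β f c) Box := by
    rw [continuousOn_pi]
    intro h
    simp only [Phi]
    apply ContinuousOn.neg
    apply continuousOn_finsetSum
    intro t _
    apply ContinuousOn.mul continuousOn_const
    apply (hfc h).comp (by fun_prop)
    intro c hc
    exact (hc h (mem_univ _) t (mem_univ _)).1
  set K := (Box ∩ {c | ∀ t ≤ T, 0 ≤ Ag τ δ A0 L r ω (fun t => ∑ h, c h t) (t+1)}) ∩
    (Box ∩ (fun c => Phi T β f c) ⁻¹' Iic (Phi T β u cbar)) with hK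
  have hBoxcl : IsClosed Box := hBoxc.isClosed
  have hKc : IsCompact K := by
    apply IsCompact.inter_right
    · apply hBoxc.inter_right
      simp only [setOf_forall]
      refine isClosed_iInter fun t => isClosed_iInter fun _ => ?_
      exact isClosed_le continuous_const (Ag_cont τ δ A0 L r ω _ (fun t => by fun_prop) _)
    · exact hPc.preimage_isClosed_of_isClosed hBoxcl isClosed_Iic
  have himg := hKc.image_of_continuousOn (hPc.mono fun c hc => hc.1.1)
  convert himg using 1
  ext y
  constructor
  · rintro ⟨c, a, hf, rfl, hle⟩
    obtain ⟨hcp, hA⟩ := feas_iff.1 ⟨a, hf⟩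
    have hcC := hbound c hcp hA
    have hcm : ∀ h, ∀ t ≤ T, m h ≤ c h t := by
      intro h
      apply hfm h (c h) (fun t ht => ⟨hcp h t ht, hcC h t ht⟩)
      have := hle h
      simp only [Phi] at this ⊢
      linarith
    have hmin : ∀ t, min t T ≤ T := fun t => min_le_right _ _
    have heq : Phi T β f (fun h t => c h (min t T)) = Phi T β u c := by
      rw [hPf _ fun h t _ => hcp h _ (hmin t)]
      funext h
      simp only [Phi]
      congr 1
      apply Finset.sum_congr rfl
      intro t ht
      rw [min_eq_left (by simp at ht; omega)]
    have hbx : (fun h t => c h (min t T)) ∈ Box := fun h _ t _ =>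
      ⟨hcm h _ (hmin t), hcC h _ (hmin t)⟩
    refine ⟨fun h t => c h (min t T), ⟨⟨hbx, ?_⟩, hbx, ?_⟩, heq⟩
    · intro t ht
      rw [Ag_congr τ δ A0 L r ω (fun t => ∑ h, c h t) _ T ?_ (t+1) (by omega)]
      · exact hA t ht
      · intro t ht
        simp only [min_eq_left ht]
    · show Phi T β f (fun h t => c h (min t T)) ≤ Phi T β u cbar
      rw [heq]
      exact hle
  · rintro ⟨c, ⟨⟨hbx, hA⟩, _, hle⟩, rfl⟩
    have hle : ∀ h, Phi T β f c h ≤ Phi T β u cbar h := hle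
    have hcm : ∀ h t, m h ≤ c h t := fun h t => (hbx h (mem_univ _) t (mem_univ _)).1
    have hc0 : ∀ h t, 0 ≤ c h t := fun h t => (hm0 h).trans (hcm h t)
    have hmz : ∀ h t, c h t = 0 → m h = 0 := fun h t h1 =>
      le_antisymm (by rw [← h1]; exact hcm h t) (hm0 h)
    have hmono := fun h => (util_mono (u h) (u' h) (hu1 h) (hu'pos h))
    obtain ⟨e, hep, hAe, hup⟩ := perturb H T r ω β τ δ A0 L (fun h => (hβ h).1) f u' hfderiv hu'pos
      c cbar (fun h t _ => hc0 h t) hbpos (fun h t _ h1 => (hfz h (hmz h t h1)).1) (by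
        intro h
        by_contra hno
        push Not at hno
        have hz : ∀ t ≤ T, c h t = 0 := fun t ht => le_antisymm (hno t ht) (hc0 h t)
        have h1 := hle h
        rw [← hPf cbar hbpos] at h1
        simp only [Phi, neg_le_neg_iff] at h1
        refine absurd h1 (not_le.2 ?_)
        apply Finset.sum_lt_sum_of_nonempty (by simp)
        intro t ht
        have ht : t ≤ T := by simp at ht; omega
        rw [hz t ht]
        exact mul_lt_mul_of_pos_left ((hfz h (hmz h t (hz t ht))).2 _ (hbpos h t ht))
          (pow_pos (hβ h).1 t)) hA hAb
    have hdis := fun h => disposal T (β h) (hβ h).1 (u h)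
      (fun x hx => (hu1 h x hx).continuousAt.continuousWithinAt) (hmono h).monotoneOn
      (e h) (cbar h) (-Phi T β f c h) (hep h) (hbpos h) (by
        have h1 := hPf e hep
        have h2 := congrFun h1 h
        have h3 := hup h
        simp only [Phi] at h2 ⊢
        linarith) (by
        have := hle h
        simp only [Phi] at this ⊢
        linarith)
    choose g hg hgy using hdis
    have hgP : Phi T β f c = Phi T β u g := by
      funext h
      have := hgy h
      rw [Phi.eq_def T β u g h, this, neg_neg]
    obtain ⟨a, ha⟩ := (feas_iff (H := H) (T := T) (r := r) (ω := ω) (l := l) (a0 := a0) (τ := τ)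
      (δ := δ) (c := g)).2 ⟨fun h t ht => (hg h t ht).1, fun t ht => (hAe t ht).trans
        (Ag_anti τ δ A0 L r ω _ _ T hτ0.le hR
          (fun t ht => Finset.sum_le_sum fun h _ => (hg h t ht).2) (t+1) (by omega))⟩
    refine ⟨g, a, ha, hgP, fun h => ?_⟩
    rw [← hgP]
    exact hle h
end

section
/- Fix weights θ_h > 0 for h = 1,…,H. Let ν = (ν_1,…,ν_T) with ν_t ≥ 0 for all t and let c_T^h > 0 for h = 1,…,H be given. Define c_t^h backwards for t = T,…,1 as the unique positive solution of (u^h)'(c_{t−1}^h) = β^h (τ(1+r_t) − δ) (u^h)'(c_t^h) + τ ν_t / ((β^h)^{t−1} θ_h) (which exists by the Inada conditions since the right-hand side is positive), and define a_t^h forwards by a_{t+1}^h = τ ω_t l^h + (τ(1+r_t) − δ) a_t^h − τ c_t^h for t = 0,…,T−1 from the given a_0^h. If ν_t Σ_{h=1}^H a_t^h = 0 and Σ_{h=1}^H a_t^h ≥ 0 for t = 1,…,T, and τ ω_T l^h + (τ(1+r_T) − δ) a_T^h − τ c_T^h = 0 for every h = 1,…,H, then the resulting point ((c_t^h),(a_t^h))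 is a Pareto optimal solution of the generalized Ramsey model without default. -/
/-- Feasibility for the generalized Ramsey model WITHOUT default:
here the capital stocks are `a h t` for `t = 0,…,T` (with `a h 0 = a0 h`),
the capital at time `T+1` is required to vanish for each household. -/
def FeasibleND (H T : ℕ) (r ω : ℕ → ℝ) (l : Fin H → ℝ) (τ δ : ℝ)
    (a0 : Fin H → ℝ) (c a : Fin H → ℕ → ℝ) : Prop :=
  (∀ h, a h 0 = a0 h) ∧
  (∀ h : Fin H, ∀ t ≤ T, 0 < c h t) ∧
  (∀ h : Fin H, ∀ t < T,
    a h (t + 1) = τ * ω t * l h + (τ * (1 + r t) - δ) * a h t - τ * c h t) ∧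
  (∀ h : Fin H, 0 = τ * ω T * l h + (τ * (1 + r T) - δ) * a h T - τ * c h T) ∧
  (∀ t, 1 ≤ t → t ≤ T → 0 ≤ ∑ h, a h t)

/-- Pareto optimality for the model without default. -/
def ParetoND (H T : ℕ) (r ω : ℕ → ℝ) (l β : Fin H → ℝ) (τ δ : ℝ)
    (a0 : Fin H → ℝ) (u : Fin H → ℝ → ℝ) (c a : Fin H → ℕ → ℝ) : Prop :=
  FeasibleND H T r ω l τ δ a0 c a ∧
  ¬ ∃ c' a' : Fin H → ℕ → ℝ, FeasibleND H T r ω l τ δ a0 c' a' ∧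
      (∀ h : Fin H, Phi T β u c' h ≤ Phi T β u c h) ∧
      (∃ h : Fin H, Phi T β u c' h < Phi T β u c h)

/-- Tangent line inequality for a function with negative second derivative on `(0,∞)`. -/
theorem tangent_ineq_aux (f f' f'' : ℝ → ℝ)
    (h1 : ∀ x > (0:ℝ), HasDerivAt f (f' x) x)
    (h2 : ∀ x > (0:ℝ), HasDerivAt f' (f'' x) x)
    (h3 : ∀ x > (0:ℝ), f'' x < 0) (x y : ℝ) (hx : 0 < x) (hy : 0 < y) :
    f y - f x ≤ f' x * (y - x) := by
  have anti : ∀ p q : ℝ, 0 < p → p < q → f' q ≤ f' p := by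
    intro p q hp hpq
    obtain ⟨m, hm, he⟩ := exists_hasDerivAt_eq_slope f' f'' hpq
      (fun z hz => (h2 z (lt_of_lt_of_le hp hz.1)).continuousAt.continuousWithinAt)
      (fun z hz => h2 z (hp.trans hz.1))
    have hneg := h3 m (hp.trans hm.1)
    rw [eq_div_iff (by linarith)] at he
    nlinarith
  rcases lt_trichotomy x y with hxy | hxy | hxy
  · obtain ⟨m, hm, he⟩ := exists_hasDerivAt_eq_slope f f' hxy
      (fun z hz => (h1 z (lt_of_lt_of_le hx hz.1)).continuousAt.continuousWithinAt)
      (fun z hz => h1 z (hx.trans hz.1))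
    have := anti x m hx hm.1
    rw [eq_div_iff (by linarith)] at he
    nlinarith
  · subst hxy; simp
  · obtain ⟨m, hm, he⟩ := exists_hasDerivAt_eq_slope f f' hxy
      (fun z hz => (h1 z (lt_of_lt_of_le hy hz.1)).continuousAt.continuousWithinAt)
      (fun z hz => h1 z (hy.trans hz.1))
    have := anti m x (hy.trans hm.1) hm.2
    rw [eq_div_iff (by linarith)] at he
    nlinarith

/-- Summation by parts along the budget recursion. -/
theorem telescoping_aux (T : ℕ) (τ : ℝ) (R p ν d e : ℕ → ℝ) (h0 : d 0 = 0)
    (hd : ∀ t < T, d (t + 1) = R t * d t - τ * e t)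
    (hT : 0 = R T * d T - τ * e T)
    (hp : ∀ t < T, p t = R (t + 1) * p (t + 1) + τ * ν (t + 1)) :
    τ * ∑ t ∈ Finset.range (T + 1), p t * e t
      = -(τ * ∑ t ∈ Finset.range T, ν (t + 1) * d (t + 1)) := by
  have key : ∀ n ≤ T, τ * ∑ t ∈ Finset.range n, p t * e t
      = -(τ * ∑ t ∈ Finset.range n, ν (t + 1) * d (t + 1)) - R n * p n * d n := by
    intro n
    induction n with
    | zero => intro _; simp [h0]
    | succ n ih =>
      intro hn
      have i1 := ih (by omega)
      have i2 := hd n (by omega)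
      have i3 := hp n (by omega)
      rw [Finset.sum_range_succ, Finset.sum_range_succ]
      linear_combination i1 + p n * i2 - d (n + 1) * i3
  rw [Finset.sum_range_succ]
  linear_combination key T le_rfl + p T * hT

/-- converse direction, no default: fixing weights `θ_h > 0`,
nonnegative multipliers `ν_1,…,ν_T` and final consumptions `c_T^h > 0`, if `c`
is obtained by the backward recursion, `a` by the forward recursion from the
given `a_0^h`, and complementary slackness, nonnegativity of the aggregate
capital stock and the vanishing of the final capital hold, then the point
`((c_t^h),(a_t^h))` is Pareto optimal for the model without default. -/
theorem multiplier_system_implies_pareto_no_default (H T : ℕ)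
    (hH : 1 ≤ H) (hT : 1 ≤ T)
    (r ω : ℕ → ℝ) (l β : Fin H → ℝ) (τ δ : ℝ) (a0 : Fin H → ℝ)
    (hr : ∀ t ≤ T, 0 < r t) (hω : ∀ t ≤ T, 1 ≤ ω t)
    (hl : ∀ h, 0 < l h) (hβ : ∀ h, 0 < β h ∧ β h < 1)
    (hτ : 1 ≤ τ) (hδ0 : 0 < δ) (hδ1 : δ < 1)
    (ha0 : 0 < ∑ h, a0 h)
    (u u' u'' : Fin H → ℝ → ℝ)
    (hu1 : ∀ h : Fin H, ∀ x > (0:ℝ), HasDerivAt (u h) (u' h x) x)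
    (hu2 : ∀ h : Fin H, ∀ x > (0:ℝ), HasDerivAt (u' h) (u'' h x) x)
    (hu2c : ∀ h : Fin H, ContinuousOn (u'' h) (Set.Ioi 0))
    (hu'pos : ∀ h : Fin H, ∀ x > (0:ℝ), 0 < u' h x)
    (hu''neg : ∀ h : Fin H, ∀ x > (0:ℝ), u'' h x < 0)
    (hu'top : ∀ h : Fin H, Filter.Tendsto (u' h) Filter.atTop (nhds 0))
    (hu'zero : ∀ h : Fin H,
      Filter.Tendsto (u' h) (nhdsWithin 0 (Set.Ioi 0)) Filter.atTop)
    (θ : Fin H → ℝ) (ν : ℕ → ℝ) (c a : Fin H → ℕ → ℝ)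
    (hθ : ∀ h : Fin H, 0 < θ h)
    (hν : ∀ t, 1 ≤ t → t ≤ T → 0 ≤ ν t)
    -- `c_T^h > 0` given, and `c_{t−1}^h > 0` obtained by the backward recursion
    (hcpos : ∀ h : Fin H, ∀ t ≤ T, 0 < c h t)
    (hc : ∀ h : Fin H, ∀ t, 1 ≤ t → t ≤ T →
      u' h (c h (t - 1)) =
        β h * (τ * (1 + r t) - δ) * u' h (c h t)
          + τ * ν t / (β h ^ (t - 1) * θ h))
    -- forward recursion for `a` from the given `a_0^h`
    (ha0' : ∀ h : Fin H, a h 0 = a0 h)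
    (ha : ∀ h : Fin H, ∀ t < T,
      a h (t + 1) = τ * ω t * l h + (τ * (1 + r t) - δ) * a h t - τ * c h t)
    -- complementary slackness and aggregate constraints
    (hcs : ∀ t, 1 ≤ t → t ≤ T → ν t * ∑ h, a h t = 0)
    (hagg : ∀ t, 1 ≤ t → t ≤ T → 0 ≤ ∑ h, a h t)
    -- the capital at the final time vanishes
    (hfin : ∀ h : Fin H,
      τ * ω T * l h + (τ * (1 + r T) - δ) * a h T - τ * c h T = 0) :
    ParetoND H T r ω l β τ δ a0 u c a := by
  refine ⟨⟨ha0', hcpos, ha, fun h => (hfin h).symm, hagg⟩, ?_⟩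
  rintro ⟨c', a', ⟨b0, bpos, b1, bT, bagg⟩, hle, h₀, hlt⟩
  have hτ0 : 0 < τ := by linarith
  have hparts : ∀ h, τ * ∑ t ∈ Finset.range (T + 1),
      (θ h * β h ^ t * u' h (c h t)) * (c' h t - c h t)
      = -(τ * ∑ t ∈ Finset.range T, ν (t + 1) * (a' h (t + 1) - a h (t + 1))) := by
    intro h
    refine telescoping_aux T τ (fun t => τ * (1 + r t) - δ)
      (fun t => θ h * β h ^ t * u' h (c h t)) ν (fun t => a' h t - a h t)
      (fun t => c' h t - c h t) ?_ ?_ ?_ ?_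
    · simp [b0, ha0']
    · intro t ht
      simp only [b1 h t ht, ha h t ht]
      ring
    · linear_combination bT h + hfin h
    · intro t ht
      have hx := hc h (t + 1) (by omega) (by omega)
      have hb : β h ^ t * θ h ≠ 0 := (mul_pos (pow_pos (hβ h).1 t) (hθ h)).ne'
      simp only [Nat.add_sub_cancel] at hx
      have hy : τ * ν (t + 1) / (β h ^ t * θ h) * (β h ^ t * θ h) = τ * ν (t + 1) :=
        div_mul_cancel₀ _ hb
      simp only [pow_succ]
      linear_combination (β h ^ t * θ h) * hx + hy
  have hconc : ∀ h, θ h * (Phi T β u c h - Phi T β u c' h) ≤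
      ∑ t ∈ Finset.range (T + 1), (θ h * β h ^ t * u' h (c h t)) * (c' h t - c h t) := by
    intro h
    have : θ h * (Phi T β u c h - Phi T β u c' h) =
        ∑ t ∈ Finset.range (T + 1), θ h * β h ^ t * (u h (c' h t) - u h (c h t)) := by
      simp only [Phi, mul_sub, Finset.sum_sub_distrib, mul_assoc, ← Finset.mul_sum]
      ring
    rw [this]
    refine Finset.sum_le_sum fun t ht => ?_
    have ht' : t ≤ T := by have := Finset.mem_range.1 ht; omega
    have htan := tangent_ineq_aux (u h) (u' h) (u'' h) (hu1 h) (hu2 h) (hu''neg h)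
      (c h t) (c' h t) (hcpos h t ht') (bpos h t ht')
    have hk : 0 ≤ θ h * β h ^ t := (mul_pos (hθ h) (pow_pos (hβ h).1 t)).le
    rw [mul_assoc _ (u' h (c h t))]
    exact mul_le_mul_of_nonneg_left htan hk
  have hpos : 0 < ∑ h, θ h * (Phi T β u c h - Phi T β u c' h) :=
    Finset.sum_pos' (fun h _ => mul_nonneg (hθ h).le (sub_nonneg.2 (hle h)))
      ⟨h₀, Finset.mem_univ _, mul_pos (hθ h₀) (sub_pos.2 hlt)⟩
  have hnn : 0 ≤ ∑ h, ∑ t ∈ Finset.range T, ν (t + 1) * (a' h (t + 1) - a h (t + 1)) := by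
    rw [Finset.sum_comm]
    refine Finset.sum_nonneg fun t ht => ?_
    have ht' := Finset.mem_range.1 ht
    rw [← Finset.mul_sum, Finset.sum_sub_distrib, mul_sub,
      hcs (t + 1) (by omega) (by omega), sub_zero]
    exact mul_nonneg (hν _ (by omega) (by omega)) (bagg _ (by omega) (by omega))
  have hsum := Finset.sum_le_sum fun h (_ : h ∈ Finset.univ) => hconc h
  have heq := Finset.sum_congr rfl fun h (_ : h ∈ Finset.univ) => hparts h
  rw [← Finset.mul_sum, Finset.sum_neg_distrib, ← Finset.mul_sum] at heq
  have := mul_pos hτ0 (lt_of_lt_of_le hpos hsum)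
  have := mul_nonneg hτ0.le hnn
  linarith
end
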